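/- Let d ≥ 1 be an integer, let f : [0,∞) → (0,∞) be Lipschitz with f(s) ≤ f(0) =: θ for all s ≥ 0, let φ : B₁' → ℝ be of class C^{1,1}, and let u be a solution of the two-phase thin obstacle problem in B₁ whose tangential gradient ∇_x u belongs to L²(B₁⁺). Then there exists C > 0, depending only on d and the Lipschitz constant of f, such that |∇_x u| ≤ C(‖∇_x u‖_{L²(B₁⁺)} + ‖∇φ‖_{L^∞(B₁')}) everywhere in B_{1/2}⁺. -/

import Mathlib

open MeasureTheory Set

/-- Euclidean space `ℝ^d`. -/
abbrev Esp (d : ℕ) := EuclideanSpace ℝ (Fin d)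

/-- The upper half-ball `B_r⁺ = B_r ∩ {y > 0}` in `ℝ^{d+1} = ℝ^d × ℝ`. -/
def upBall (d : ℕ) (r : ℝ) : Set (Esp d × ℝ) := {p | ‖p.1‖^2 + p.2^2 < r^2 ∧ 0 < p.2}

/-- The thin ball `B_r' = B_r ∩ {y = 0}` in `ℝ^{d+1} = ℝ^d × ℝ`. -/
def flatBall (d : ℕ) (r : ℝ) : Set (Esp d × ℝ) := {p | ‖p.1‖^2 + p.2^2 < r^2 ∧ p.2 = 0}

/-- Laplacian on `ℝ^d × ℝ`, computed through iterated coordinate derivatives. -/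
noncomputable def lapH (d : ℕ) (u : Esp d × ℝ → ℝ) (p : Esp d × ℝ) : ℝ :=
  (∑ i : Fin d,
    deriv (deriv (fun t : ℝ => u (p.1 + t • EuclideanSpace.single i (1:ℝ), p.2))) 0)
  + deriv (deriv (fun t : ℝ => u (p.1, p.2 + t))) 0

/-- `u` is harmonic on the open set `U`: it is `C²` there and its Laplacian vanishes. -/
def HarmonicOnH (d : ℕ) (u : Esp d × ℝ → ℝ) (U : Set (Esp d × ℝ)) : Prop :=
  ContDiffOn ℝ 2 u U ∧ ∀ p ∈ U, lapH d u p = 0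

/-- Vertical partial derivative `∂_y u`. -/
noncomputable def pdy (d : ℕ) (u : Esp d × ℝ → ℝ) (p : Esp d × ℝ) : ℝ :=
  deriv (fun t : ℝ => u (p.1, p.2 + t)) 0

/-- Squared norm of the tangential gradient `|∇_x u|²`. -/
noncomputable def tangGradSq (d : ℕ) (u : Esp d × ℝ → ℝ) (p : Esp d × ℝ) : ℝ :=
  ∑ i : Fin d,
    (deriv (fun t : ℝ => u (p.1 + t • EuclideanSpace.single i (1:ℝ), p.2)) 0)^2

/-- Squared norm of the full gradient `|∇u|²`. -/
noncomputable def gradSqH (d : ℕ) (u : Esp d × ℝ → ℝ) (p : Esp d × ℝ) : ℝ :=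
  tangGradSq d u p + (pdy d u p)^2

/-- `L` is the one-sided vertical derivative `∂_y u(x,0⁺)`. -/
def NormalDeriv (d : ℕ) (u : Esp d × ℝ → ℝ) (x : Esp d) (L : ℝ) : Prop :=
  Filter.Tendsto (fun t => (u (x, t) - u (x, 0)) / t) (nhdsWithin 0 (Set.Ioi 0)) (nhds L)

/-- `f : [0,∞) → (0,∞)` is `L`-Lipschitz with `f ≤ f 0 = θ`. -/
def GoodF (θ L : ℝ) (f : ℝ → ℝ) : Prop :=
  f 0 = θ ∧ (∀ s : ℝ, 0 ≤ s → 0 < f s ∧ f s ≤ θ) ∧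
  (∀ s t : ℝ, 0 ≤ s → 0 ≤ t → |f s - f t| ≤ L * |s - t|)

/-- `u` is a solution of the two-phase thin obstacle problem in `B₁` with nonlinearity `f`
and obstacle `φ`: continuous on `B₁⁺ ∪ B₁'`, harmonic in `B₁⁺`, and on `B₁'` the one-sided
vertical derivative exists, is bounded by `θ` in absolute value, and equals
`f(|u−φ|)·sign(u−φ)` off the contact set. -/
def TwoPhaseSolH (d : ℕ) (θ : ℝ) (f : ℝ → ℝ) (φ : Esp d → ℝ) (u : Esp d × ℝ → ℝ) : Prop :=
  ContinuousOn u (upBall d 1 ∪ flatBall d 1) ∧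
  HarmonicOnH d u (upBall d 1) ∧
  ∀ x : Esp d, ‖x‖ < 1 → ∃ L : ℝ, NormalDeriv d u x L ∧ |L| ≤ θ ∧
    (u (x, 0) ≠ φ x → L = f |u (x, 0) - φ x| * Real.sign (u (x, 0) - φ x))

/-- `φ` is of class `C^{1,1}` on `B₁'` with `C^{1,1}` norm at most `P`. -/
def C11Bound (d : ℕ) (P : ℝ) (φ : Esp d → ℝ) : Prop :=
  (∀ x : Esp d, ‖x‖ < 1 → DifferentiableAt ℝ φ x ∧ |φ x| ≤ P ∧ ‖fderiv ℝ φ x‖ ≤ P) ∧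
  (∀ x y : Esp d, ‖x‖ < 1 → ‖y‖ < 1 → ‖fderiv ℝ φ x - fderiv ℝ φ y‖ ≤ P * ‖x - y‖)

section MeanValue

/-- The squared Euclidean norm on `ℝ^d × ℝ`. -/
noncomputable def euclSq (d : ℕ) (q : Esp d × ℝ) : ℝ := ‖q.1‖ ^ 2 + q.2 ^ 2

/-- A radial averaging kernel supported in the Euclidean unit ball. -/
noncomputable def avgKernel (d : ℕ) (q : Esp d × ℝ) : ℝ := 4 * max 0 (1 - euclSq d q)

/-- A potential of the averaging kernel: `∇ (kernelPot) = - avgKernel • id`. -/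
noncomputable def kernelPot (d : ℕ) (q : Esp d × ℝ) : ℝ := (max 0 (1 - euclSq d q)) ^ 2

/-- The `i`-th tangential unit vector of `ℝ^d × ℝ`. -/
noncomputable def tangVec (d : ℕ) (i : Fin d) : Esp d × ℝ := (EuclideanSpace.single i 1, 0)

/-- The vertical unit vector of `ℝ^d × ℝ`. -/
def vertVec (d : ℕ) : Esp d × ℝ := (0, 1)

variable {d : ℕ}

lemma continuous_euclSq : Continuous (euclSq d) := by
  unfold euclSq; fun_prop

lemma continuous_avgKernel : Continuous (avgKernel d) :=
  continuous_const.mul (continuous_const.max (continuous_const.sub continuous_euclSq))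

lemma continuous_kernelPot : Continuous (kernelPot d) :=
  (continuous_const.max (continuous_const.sub continuous_euclSq)).pow 2

lemma one_lt_euclSq {q : Esp d × ℝ} (hq : 1 < ‖q‖) : 1 < euclSq d q := by
  unfold euclSq
  rcases lt_max_iff.1 (Prod.norm_def q ▸ hq) with h | h
  · nlinarith [sq_nonneg q.2, norm_nonneg q.1]
  · rw [Real.norm_eq_abs] at h
    nlinarith [sq_nonneg ‖q.1‖, sq_abs q.2]

lemma avgKernel_eq_zero {q : Esp d × ℝ} (hq : q ∉ Metric.closedBall 0 1) :
    avgKernel d q = 0 := by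
  have := one_lt_euclSq (d := d) (q := q) (by simpa using hq)
  simp [avgKernel, this.le]

lemma kernelPot_eq_zero {q : Esp d × ℝ} (hq : q ∉ Metric.closedBall 0 1) :
    kernelPot d q = 0 := by
  have := one_lt_euclSq (d := d) (q := q) (by simpa using hq)
  simp [kernelPot, this.le]

lemma avgKernel_nonneg (q : Esp d × ℝ) : 0 ≤ avgKernel d q :=
  mul_nonneg (by norm_num) (le_max_left _ _)

lemma avgKernel_le (q : Esp d × ℝ) : avgKernel d q ≤ 4 := by
  have : 0 ≤ euclSq d q := by unfold euclSq; positivity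
  have : max 0 (1 - euclSq d q) ≤ 1 := max_le zero_le_one (by linarith)
  unfold avgKernel; linarith

lemma hasCompactSupport_avgKernel : HasCompactSupport (avgKernel d) :=
  HasCompactSupport.intro (isCompact_closedBall 0 1) fun _ h => avgKernel_eq_zero h

lemma hasCompactSupport_kernelPot : HasCompactSupport (kernelPot d) :=
  HasCompactSupport.intro (isCompact_closedBall 0 1) fun _ h => kernelPot_eq_zero h

instance : (volume : Measure (Esp d × ℝ)).IsAddHaarMeasure := by
  rw [Measure.volume_eq_prod]; infer_instance

lemma integral_avgKernel_pos : 0 < ∫ q, avgKernel d q := by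
  refine continuous_avgKernel.integral_pos_of_hasCompactSupport_nonneg_nonzero
    hasCompactSupport_avgKernel avgKernel_nonneg (x := 0) ?_
  simp [avgKernel, euclSq]

lemma hasDerivAt_max_zero_sq (s : ℝ) :
    HasDerivAt (fun s : ℝ => (max 0 s) ^ 2) (2 * max 0 s) s := by
  rcases lt_trichotomy s 0 with h | rfl | h
  · rw [max_eq_left h.le, mul_zero]
    refine (hasDerivAt_const s (0 : ℝ)).congr_of_eventuallyEq ?_
    filter_upwards [Iio_mem_nhds h] with t ht
    have ht' : t ≤ 0 := le_of_lt ht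
    simp [ht']
  · rw [max_self, mul_zero, hasDerivAt_iff_isLittleO]
    simp only [max_self, sub_zero, smul_zero, ne_eq, OfNat.ofNat_ne_zero, not_false_eq_true,
      zero_pow]
    have h2 : (fun x : ℝ => x ^ 2) =o[nhds 0] fun x => x := by
      simpa using Asymptotics.isLittleO_pow_id (𝕜 := ℝ) (n := 2) (by norm_num)
    refine Asymptotics.IsBigO.trans_isLittleO (Asymptotics.IsBigO.of_bound 1 ?_) h2
    refine Filter.Eventually.of_forall fun x => ?_
    rw [Real.norm_of_nonneg (sq_nonneg _), Real.norm_of_nonneg (sq_nonneg _), one_mul]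
    rcases le_total 0 x with hx | hx
    · rw [max_eq_right hx]
    · rw [max_eq_left hx]; nlinarith
  · rw [max_eq_right h.le]
    have := hasDerivAt_pow 2 s
    norm_num at this
    refine this.congr_of_eventuallyEq ?_
    filter_upwards [Ioi_mem_nhds h] with t ht
    have ht' : 0 ≤ t := le_of_lt ht
    simp [ht']

lemma hasFDerivAt_kernelPot (q : Esp d × ℝ) :
    ∃ D : (Esp d × ℝ) →L[ℝ] ℝ, HasFDerivAt (kernelPot d) D q ∧
      ∀ v : Esp d × ℝ, D v = -(avgKernel d q * (inner ℝ q.1 v.1 + q.2 * v.2)) := by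
  have h1 : HasFDerivAt (fun q : Esp d × ℝ => ‖q.1‖ ^ 2)
      ((2 • (innerSL ℝ q.1)).comp (ContinuousLinearMap.fst ℝ (Esp d) ℝ)) q :=
    (hasStrictFDerivAt_norm_sq q.1).hasFDerivAt.comp q hasFDerivAt_fst
  have h2 : HasFDerivAt (fun q : Esp d × ℝ => q.2 ^ 2) _ q := (hasFDerivAt_snd (𝕜 := ℝ)).pow 2
  have h3 := (hasDerivAt_max_zero_sq (1 - euclSq d q)).comp_hasFDerivAt q
    ((h1.add h2).const_sub 1)
  refine ⟨_, h3, fun v => ?_⟩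
  simp [avgKernel]
  ring

lemma lapH_eq_fderiv {g : Esp d × ℝ → ℝ} (hg : ContDiff ℝ 2 g) (p : Esp d × ℝ) :
    lapH d g p = (∑ i, fderiv ℝ (fun z => fderiv ℝ g z (tangVec d i)) p (tangVec d i))
      + fderiv ℝ (fun z => fderiv ℝ g z (vertVec d)) p (vertVec d) := by
  have key : ∀ v : Esp d × ℝ, deriv (deriv (fun t : ℝ => g (p + t • v))) 0 =
      fderiv ℝ (fun z => fderiv ℝ g z v) p v := by
    intro v
    have hline : ∀ t : ℝ, HasDerivAt (fun t : ℝ => p + t • v) v t := fun t => by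
      simpa using ((hasDerivAt_id t).smul_const v).const_add p
    have h1 : deriv (fun t : ℝ => g (p + t • v)) = fun t => fderiv ℝ g (p + t • v) v := by
      ext t
      exact (((hg.differentiable (by norm_num)) _).hasFDerivAt.comp_hasDerivAt t (hline t)).deriv
    rw [h1]
    have hd : Differentiable ℝ (fun z => fderiv ℝ g z v) :=
      ((hg.fderiv_right (m := 1) (by norm_num)).clm_apply contDiff_const).differentiable
        (by norm_num)
    have := ((hd (p + (0 : ℝ) • v)).hasFDerivAt.comp_hasDerivAt 0 (hline 0)).deriv
    simpa [Function.comp_def] using this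
  unfold lapH
  congr 1
  · refine Finset.sum_congr rfl fun i _ => ?_
    rw [← key]
    congr 3
    ext t
    congr 1
    ext <;> simp [tangVec]
  · rw [← key]
    congr 3
    ext t
    congr 1
    ext <;> simp [vertVec]

lemma integral_avgKernel_mul_fderiv {g : Esp d × ℝ → ℝ} (hg : ContDiff ℝ 2 g)
    (p : Esp d × ℝ) (t : ℝ) :
    ∫ q, avgKernel d q * fderiv ℝ g (p + t • q) q
      = t * ∫ q, kernelPot d q * lapH d g (p + t • q) := by
  have hg1 : ContDiff ℝ 1 (fderiv ℝ g) := hg.fderiv_right (by norm_num)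
  have hga : Continuous fun q : Esp d × ℝ => fderiv ℝ g (p + t • q) :=
    hg1.continuous.comp (by fun_prop)
  have hdir : ∀ v, ContDiff ℝ 1 (fun z => fderiv ℝ g z v) := fun v =>
    hg1.clm_apply contDiff_const
  have hdd : ∀ v, Continuous fun q : Esp d × ℝ =>
      fderiv ℝ (fun z => fderiv ℝ g z v) (p + t • q) v := fun v =>
    (((hdir v).continuous_fderiv (by norm_num)).comp
      (f := fun q : Esp d × ℝ => p + t • q) (by fun_prop)).clm_apply continuous_const
  have hi1 : ∀ v : Esp d × ℝ, Integrable fun q : Esp d × ℝ =>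
      avgKernel d q * (inner ℝ q.1 v.1 + q.2 * v.2) * fderiv ℝ g (p + t • q) v := fun v => by
    refine Continuous.integrable_of_hasCompactSupport ?_ ?_
    · exact (continuous_avgKernel.mul (by fun_prop)).mul (hga.clm_apply continuous_const)
    · exact (hasCompactSupport_avgKernel.mul_right).mul_right
  have hi2 : ∀ v : Esp d × ℝ, Integrable fun q : Esp d × ℝ =>
      kernelPot d q * (t * fderiv ℝ (fun z => fderiv ℝ g z v) (p + t • q) v) := fun v => by
    refine Continuous.integrable_of_hasCompactSupport ?_ ?_
    · exact continuous_kernelPot.mul (continuous_const.mul (hdd v))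
    · exact hasCompactSupport_kernelPot.mul_right
  have hi3 : ∀ v : Esp d × ℝ, Integrable fun q : Esp d × ℝ =>
      kernelPot d q * fderiv ℝ g (p + t • q) v := fun v => by
    refine Continuous.integrable_of_hasCompactSupport ?_ ?_
    · exact continuous_kernelPot.mul (hga.clm_apply continuous_const)
    · exact hasCompactSupport_kernelPot.mul_right
  have parts : ∀ v : Esp d × ℝ,
      ∫ q : Esp d × ℝ, avgKernel d q * (inner ℝ q.1 v.1 + q.2 * v.2) * fderiv ℝ g (p + t • q) v
        = ∫ q, kernelPot d q * (t * fderiv ℝ (fun z => fderiv ℝ g z v) (p + t • q) v) := by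
    intro v
    choose D hD hDv using hasFDerivAt_kernelPot (d := d)
    have hline : ∀ q : Esp d × ℝ, HasLineDerivAt ℝ (fun q => fderiv ℝ g (p + t • q) v)
        (t * fderiv ℝ (fun z => fderiv ℝ g z v) (p + t • q) v) q v := fun q => by
      have h1 : HasFDerivAt (fun q : Esp d × ℝ => p + t • q)
          (t • ContinuousLinearMap.id ℝ (Esp d × ℝ)) q :=
        ((hasFDerivAt_id q).const_smul t).const_add p
      have h2 := (((hdir v).differentiable (by norm_num) (p + t • q)).hasFDerivAt.comp q
        h1).hasLineDerivAt v
      have h3 : (fun q => fderiv ℝ g (p + t • q) v) =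
          (fun z => fderiv ℝ g z v) ∘ fun q => p + t • q := rfl
      rw [h3]
      simpa using h2
    have := integral_bilinear_hasLineDerivAt_right_eq_neg_left_of_integrable
      (μ := (volume : Measure (Esp d × ℝ))) (v := v) (f := kernelPot d) (f' := fun q => D q v)
      (g := fun q => fderiv ℝ g (p + t • q) v)
      (g' := fun q => t * fderiv ℝ (fun z => fderiv ℝ g z v) (p + t • q) v)
      (B := ContinuousLinearMap.mul ℝ ℝ)
      (by simpa [hDv] using (hi1 v).neg) (by simpa using hi2 v) (by simpa using hi3 v)
      (fun q _ => (hD q).hasLineDerivAt v) (fun q _ => hline q)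
    simp only [ContinuousLinearMap.mul_apply'] at this
    rw [this, ← integral_neg]
    refine integral_congr_ae (Filter.Eventually.of_forall fun q => ?_)
    simp [hDv]
  have hdec : ∀ q : Esp d × ℝ, (∑ i, q.1 i • tangVec d i) + q.2 • vertVec d = q := by
    intro q
    have hs : ∑ i, q.1 i • (EuclideanSpace.single i (1 : ℝ)) = q.1 := by
      ext j
      simp [Finset.sum_apply, Pi.single_apply]
    ext1
    · simpa [tangVec, vertVec, Prod.fst_sum] using hs
    · simp [tangVec, vertVec, Prod.snd_sum]
  have hL : ∀ q : Esp d × ℝ, avgKernel d q * fderiv ℝ g (p + t • q) q =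
      (∑ i, avgKernel d q * (inner ℝ q.1 (tangVec d i).1 + q.2 * (tangVec d i).2)
          * fderiv ℝ g (p + t • q) (tangVec d i))
        + avgKernel d q * (inner ℝ q.1 (vertVec d).1 + q.2 * (vertVec d).2)
          * fderiv ℝ g (p + t • q) (vertVec d) := by
    intro q
    have hq := congrArg (fderiv ℝ g (p + t • q)) (hdec q)
    rw [← hq, map_add, map_sum, mul_add, Finset.mul_sum]
    simp only [map_smul, smul_eq_mul]
    simp [tangVec, vertVec, EuclideanSpace.inner_single_right, mul_assoc]
  have hR : ∀ q : Esp d × ℝ, t * (kernelPot d q * lapH d g (p + t • q)) =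
      (∑ i, kernelPot d q *
          (t * fderiv ℝ (fun z => fderiv ℝ g z (tangVec d i)) (p + t • q) (tangVec d i)))
        + kernelPot d q *
          (t * fderiv ℝ (fun z => fderiv ℝ g z (vertVec d)) (p + t • q) (vertVec d)) := by
    intro q
    rw [lapH_eq_fderiv hg, mul_add, mul_add, Finset.mul_sum, Finset.mul_sum]
    congr 1
    · exact Finset.sum_congr rfl fun i _ => by ring
    · ring
  rw [← integral_const_mul]
  simp_rw [hL, hR]
  rw [integral_add (integrable_finsetSum _ fun i _ => hi1 _) (hi1 _),
    integral_add (integrable_finsetSum _ fun i _ => hi2 _) (hi2 _),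
    integral_finsetSum _ fun i _ => hi1 _, integral_finsetSum _ fun i _ => hi2 _, parts]
  simp_rw [parts]

lemma hasDerivAt_integral_avgKernel {g : Esp d × ℝ → ℝ} (hg : ContDiff ℝ 1 g)
    {α β : Esp d × ℝ → Esp d × ℝ} (hα : Continuous α) (hβ : Continuous β) (t : ℝ) :
    HasDerivAt (fun t : ℝ => ∫ q, avgKernel d q * g (α q + t • β q))
      (∫ q, avgKernel d q * fderiv ℝ g (α q + t • β q) (β q)) t := by
  have hF' : Continuous fun z : ℝ × (Esp d × ℝ) =>
      avgKernel d z.2 * fderiv ℝ g (α z.2 + z.1 • β z.2) (β z.2) :=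
    (continuous_avgKernel.comp continuous_snd).mul
      (((hg.continuous_fderiv (by norm_num)).comp
        (f := fun z : ℝ × (Esp d × ℝ) => α z.2 + z.1 • β z.2) (by fun_prop)).clm_apply
        (by fun_prop))
  obtain ⟨C, hC⟩ := ((isCompact_closedBall t 1).prod
    (isCompact_closedBall (0 : Esp d × ℝ) 1)).exists_bound_of_continuousOn hF'.continuousOn
  have hcont : ∀ s : ℝ, Continuous fun q => avgKernel d q * g (α q + s • β q) := fun s =>
    continuous_avgKernel.mul (hg.continuous.comp (by fun_prop))
  refine (hasDerivAt_integral_of_dominated_loc_of_deriv_le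
    (bound := (Metric.closedBall (0 : Esp d × ℝ) 1).indicator fun _ => C)
    (F' := fun s q => avgKernel d q * fderiv ℝ g (α q + s • β q) (β q))
    (Metric.closedBall_mem_nhds t one_pos)
    (Filter.Eventually.of_forall fun s => (hcont s).aestronglyMeasurable)
    ((hcont t).integrable_of_hasCompactSupport hasCompactSupport_avgKernel.mul_right)
    (hF'.comp (Continuous.prodMk_right t)).aestronglyMeasurable
    (Filter.Eventually.of_forall fun q s hs => ?_) ?_
    (Filter.Eventually.of_forall fun q s _ => ?_)).2
  · by_cases hq : q ∈ Metric.closedBall (0 : Esp d × ℝ) 1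
    · rw [indicator_of_mem hq]
      exact hC (s, q) ⟨hs, hq⟩
    · rw [indicator_of_notMem hq, avgKernel_eq_zero hq]
      simp
  · exact (integrable_indicator_iff measurableSet_closedBall).2
      (integrableOn_const (isCompact_closedBall _ _).measure_lt_top.ne)
  · have hline : HasDerivAt (fun s : ℝ => α q + s • β q) (β q) s := by
      simpa using ((hasDerivAt_id s).smul_const (β q)).const_add (α q)
    exact (((hg.differentiable (by norm_num)) _).hasFDerivAt.comp_hasDerivAt s hline).const_mul _

/-- The weighted mean value property. -/
lemma integral_avgKernel_eq {g : Esp d × ℝ → ℝ} (hg : ContDiff ℝ 2 g) {p : Esp d × ℝ} {r : ℝ}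
    (hr : 0 ≤ r) (hlap : ∀ z ∈ Metric.closedBall p r, lapH d g z = 0) :
    ∫ q, avgKernel d q * g (p + r • q) = (∫ q, avgKernel d q) * g p := by
  have hder : ∀ t : ℝ, HasDerivAt (fun t : ℝ => ∫ q, avgKernel d q * g (p + t • q))
      (∫ q, avgKernel d q * fderiv ℝ g (p + t • q) q) t := fun t =>
    hasDerivAt_integral_avgKernel (hg.of_le (by norm_num)) continuous_const continuous_id t
  have hz : ∀ t ∈ Icc 0 r, ∫ q, avgKernel d q * fderiv ℝ g (p + t • q) q = 0 := by
    intro t ht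
    rw [integral_avgKernel_mul_fderiv hg]
    have : ∀ q, kernelPot d q * lapH d g (p + t • q) = 0 := by
      intro q
      by_cases hq : q ∈ Metric.closedBall (0 : Esp d × ℝ) 1
      · rw [hlap, mul_zero]
        rw [mem_closedBall_zero_iff] at hq
        rw [Metric.mem_closedBall, dist_eq_norm, add_sub_cancel_left, norm_smul,
          Real.norm_of_nonneg ht.1]
        nlinarith [ht.1, ht.2, norm_nonneg q]
      · rw [kernelPot_eq_zero hq, zero_mul]
    simp [this]
  have hconst := constant_of_has_deriv_right_zero (a := 0) (b := r)
    (f := fun t : ℝ => ∫ q, avgKernel d q * g (p + t • q))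
    (fun t _ => (hder t).continuousAt.continuousWithinAt)
    (fun t ht => (hz t (Ico_subset_Icc_self ht) ▸ hder t).hasDerivWithinAt) r ⟨hr, le_rfl⟩
  simpa [integral_mul_const] using hconst

end MeanValue

section Interior

variable {d : ℕ}

lemma isOpen_upBall (r : ℝ) : IsOpen (upBall d r) := by
  have h : upBall d r = {p | ‖p.1‖ ^ 2 + p.2 ^ 2 < r ^ 2} ∩ {p | 0 < p.2} := rfl
  rw [h]
  exact (isOpen_lt (by fun_prop) (by fun_prop)).inter (isOpen_lt (by fun_prop) (by fun_prop))

lemma tendsto_add_smul (p v : Esp d × ℝ) :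
    Filter.Tendsto (fun t : ℝ => p + t • v) (nhds 0) (nhds p) := by
  have : Continuous fun t : ℝ => p + t • v := by fun_prop
  simpa using this.tendsto 0

lemma hasDerivAt_add_smul (p v : Esp d × ℝ) (t : ℝ) :
    HasDerivAt (fun t : ℝ => p + t • v) v t := by
  simpa using ((hasDerivAt_id t).smul_const v).const_add p

lemma lapH_eq_lines (u : Esp d × ℝ → ℝ) (p : Esp d × ℝ) :
    lapH d u p = (∑ i, deriv (deriv fun t : ℝ => u (p + t • tangVec d i)) 0)
      + deriv (deriv fun t : ℝ => u (p + t • vertVec d)) 0 := by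
  unfold lapH
  congr 1
  · refine Finset.sum_congr rfl fun i _ => ?_
    congr 3
    ext t
    congr 1
    ext <;> simp [tangVec]
  · congr 3
    ext t
    congr 1
    ext <;> simp [vertVec]

lemma lapH_congr {u g : Esp d × ℝ → ℝ} {p : Esp d × ℝ} (h : u =ᶠ[nhds p] g) :
    lapH d u p = lapH d g p := by
  have key : ∀ v : Esp d × ℝ, deriv (deriv fun t : ℝ => u (p + t • v)) 0 =
      deriv (deriv fun t : ℝ => g (p + t • v)) 0 := fun v =>
    (h.comp_tendsto (tendsto_add_smul p v)).deriv.deriv_eq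
  simp only [lapH_eq_lines, key]

lemma hasDerivAt_tang {u : Esp d × ℝ → ℝ} {p : Esp d × ℝ} (hu : DifferentiableAt ℝ u p)
    (i : Fin d) :
    HasDerivAt (fun t : ℝ => u (p.1 + t • EuclideanSpace.single i (1 : ℝ), p.2))
      (fderiv ℝ u p (tangVec d i)) 0 := by
  have h0 : p + (0 : ℝ) • tangVec d i = p := by simp
  have h := ((h0.symm ▸ hu.hasFDerivAt :
    HasFDerivAt u (fderiv ℝ u p) (p + (0 : ℝ) • tangVec d i))).comp_hasDerivAt 0
      (hasDerivAt_add_smul p (tangVec d i) 0)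
  convert! h using 1
  ext t
  simp only [Function.comp]
  congr 1
  ext <;> simp [tangVec]

lemma tangGradSq_eq {u : Esp d × ℝ → ℝ} {p : Esp d × ℝ} (hu : DifferentiableAt ℝ u p) :
    tangGradSq d u p = ∑ i, (fderiv ℝ u p (tangVec d i)) ^ 2 := by
  simp only [tangGradSq, (hasDerivAt_tang hu _).deriv]

lemma tangGradSq_nonneg (u : Esp d × ℝ → ℝ) (p : Esp d × ℝ) : 0 ≤ tangGradSq d u p :=
  Finset.sum_nonneg fun _ _ => sq_nonneg _

/-- Weighted mean value property of the directional derivatives of a harmonic function. -/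
lemma fderiv_eq_average {u : Esp d × ℝ → ℝ} {U : Set (Esp d × ℝ)} (hU : IsOpen U)
    (hu : HarmonicOnH d u U) {p : Esp d × ℝ} {r : ℝ} (hr : 0 < r)
    (hp : Metric.closedBall p (2 * r) ⊆ U) (v : Esp d × ℝ) :
    (∫ q, avgKernel d q) * fderiv ℝ u p v
      = ∫ q, avgKernel d q * fderiv ℝ u (p + r • q) v := by
  let χ : ContDiffBump p := ⟨3 / 2 * r, 2 * r, by positivity, by linarith⟩
  let g : Esp d × ℝ → ℝ := fun z => χ z * u z
  have hg : ContDiff ℝ 2 g := contDiff_iff_contDiffAt.2 fun z => by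
    by_cases hz : z ∈ Metric.closedBall p (2 * r)
    · exact χ.contDiff.contDiffAt.mul (hu.1.contDiffAt (hU.mem_nhds (hp hz)))
    · refine (contDiffAt_const (c := (0 : ℝ))).congr_of_eventuallyEq ?_
      filter_upwards [Metric.isClosed_closedBall.isOpen_compl.mem_nhds hz] with y hy
      have : χ y = 0 := χ.zero_of_le_dist (le_of_lt (by simpa using hy))
      simp [g, this]
  have hgu : ∀ z ∈ Metric.ball p (3 / 2 * r), g =ᶠ[nhds z] u := fun z hz => by
    filter_upwards [Metric.isOpen_ball.mem_nhds hz] with y hy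
    have : χ y = 1 := χ.one_of_mem_closedBall (Metric.ball_subset_closedBall hy)
    simp [g, this]
  have hlap : ∀ z ∈ Metric.ball p (3 / 2 * r), lapH d g z = 0 := fun z hz => by
    rw [lapH_congr (hgu z hz)]
    exact hu.2 z (hp (Metric.closedBall_subset_closedBall (by linarith)
      (Metric.ball_subset_closedBall hz)))
  have hev : (fun t : ℝ => ∫ q, avgKernel d q * g (p + r • q + t • v)) =ᶠ[nhds 0]
      fun t => (∫ q, avgKernel d q) * g (p + t • v) := by
    filter_upwards [(tendsto_add_smul p v) (Metric.ball_mem_nhds p (half_pos hr))] with t ht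
    rw [← integral_avgKernel_eq hg hr.le]
    · refine integral_congr_ae (Filter.Eventually.of_forall fun q => ?_)
      simp only [add_right_comm]
    · intro z hz
      refine hlap z ?_
      have h1 : dist (p + t • v) p < r / 2 := ht
      have h2 : dist z (p + t • v) ≤ r := hz
      have := dist_triangle z (p + t • v) p
      rw [Metric.mem_ball]
      linarith
  have h1 := hasDerivAt_integral_avgKernel (hg.of_le (by norm_num)) (α := fun q => p + r • q)
    (β := fun _ => v) (by fun_prop) continuous_const 0
  have h2 : HasDerivAt (fun t : ℝ => (∫ q, avgKernel d q) * g (p + t • v))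
      ((∫ q, avgKernel d q) * fderiv ℝ g (p + (0 : ℝ) • v) v) 0 :=
    (((hg.differentiable (by norm_num)) _).hasFDerivAt.comp_hasDerivAt 0
      (hasDerivAt_add_smul p v 0)).const_mul _
  have h3 := h1.unique (h2.congr_of_eventuallyEq hev)
  simp only [zero_smul, add_zero] at h3
  rw [← (hgu p (Metric.mem_ball_self (by positivity))).fderiv_eq, ← h3]
  refine integral_congr_ae (Filter.Eventually.of_forall fun q => ?_)
  by_cases hq : q ∈ Metric.closedBall (0 : Esp d × ℝ) 1
  · have : p + r • q ∈ Metric.ball p (3 / 2 * r) := by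
      rw [mem_closedBall_zero_iff] at hq
      rw [Metric.mem_ball, dist_eq_norm, add_sub_cancel_left, norm_smul,
        Real.norm_of_nonneg hr.le]
      nlinarith
    simp only [(hgu _ this).fderiv_eq]
  · simp [avgKernel_eq_zero hq]

lemma abs_fderiv_tang_le {u : Esp d × ℝ → ℝ} {U : Set (Esp d × ℝ)} (hU : IsOpen U)
    (hu : HarmonicOnH d u U) (hIb : IntegrableOn (fun p => tangGradSq d u p) U) {a : ℝ}
    (ha : 0 < a) (hle : ∫ q in U, tangGradSq d u q ≤ a ^ 2) {p : Esp d × ℝ} {r : ℝ} (hr : 0 < r)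
    (hp : Metric.closedBall p (2 * r) ⊆ U) (i : Fin d) :
    |fderiv ℝ u p (tangVec d i)| ≤
      a * (1 / 2 + 2 / (∫ q, avgKernel d q) * (r ^ (d + 1))⁻¹) := by
  set c := ∫ q, avgKernel d q with hc
  have hc0 : 0 < c := integral_avgKernel_pos
  set H : Esp d × ℝ → ℝ := U.indicator fun p => tangGradSq d u p with hH
  have hHi : Integrable H := (integrable_indicator_iff hU.measurableSet).2 hIb
  have hH0 : ∀ z, 0 ≤ H z := fun z => indicator_nonneg (fun _ _ => tangGradSq_nonneg _ _) z
  have hHr : Integrable fun q : Esp d × ℝ => H (p + r • q) :=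
    (hHi.comp_add_left p).comp_smul hr.ne'
  have hHint : ∫ q : Esp d × ℝ, H (p + r • q) ≤ (r ^ (d + 1))⁻¹ * a ^ 2 := by
    rw [Measure.integral_comp_smul volume (fun z => H (p + z)) r,
      integral_add_left_eq_self H p, integral_indicator hU.measurableSet, smul_eq_mul,
      abs_of_nonneg (by positivity)]
    have : Module.finrank ℝ (Esp d × ℝ) = d + 1 := by simp
    rw [this]
    gcongr
  have hker : Integrable (avgKernel d) :=
    continuous_avgKernel.integrable_of_hasCompactSupport hasCompactSupport_avgKernel
  have hbd : ‖∫ q, avgKernel d q * fderiv ℝ u (p + r • q) (tangVec d i)‖ ≤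
      ∫ q, (avgKernel d q * (a / 2) + 2 / a * H (p + r • q)) := by
    refine norm_integral_le_of_norm_le ((hker.mul_const _).add (hHr.const_mul _))
      (Filter.Eventually.of_forall fun q => ?_)
    have hk0 := avgKernel_nonneg q
    by_cases hq : q ∈ Metric.closedBall (0 : Esp d × ℝ) 1
    · have hz : p + r • q ∈ U := hp <| by
        rw [mem_closedBall_zero_iff] at hq
        rw [Metric.mem_closedBall, dist_eq_norm, add_sub_cancel_left, norm_smul,
          Real.norm_of_nonneg hr.le]
        nlinarith
      have hdiff : DifferentiableAt ℝ u (p + r • q) :=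
        (hu.1.contDiffAt (hU.mem_nhds hz)).differentiableAt (by norm_num)
      have hHz : (fderiv ℝ u (p + r • q) (tangVec d i)) ^ 2 ≤ H (p + r • q) := by
        rw [hH, indicator_of_mem hz, tangGradSq_eq hdiff]
        exact Finset.single_le_sum
          (f := fun i => (fderiv ℝ u (p + r • q) (tangVec d i)) ^ 2)
          (fun _ _ => sq_nonneg _) (Finset.mem_univ i)
      set F := fderiv ℝ u (p + r • q) (tangVec d i)
      have hF : |F| ≤ a / 2 + F ^ 2 / (2 * a) := by
        have : a / 2 + F ^ 2 / (2 * a) - |F| = (|F| - a) ^ 2 / (2 * a) := by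
          field_simp
          rw [← sq_abs F]
          ring
        have h2 : 0 ≤ (|F| - a) ^ 2 / (2 * a) := by positivity
        linarith
      rw [norm_mul, Real.norm_of_nonneg hk0, Real.norm_eq_abs]
      calc avgKernel d q * |F| ≤ avgKernel d q * (a / 2 + F ^ 2 / (2 * a)) := by gcongr
        _ = avgKernel d q * (a / 2) + avgKernel d q * (F ^ 2 / (2 * a)) := by ring
        _ ≤ avgKernel d q * (a / 2) + 4 * (H (p + r • q) / (2 * a)) := by
            gcongr
            exact avgKernel_le q
        _ = _ := by
            field_simp
            ring
    · rw [avgKernel_eq_zero hq]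
      have := hH0 (p + r • q)
      simp only [zero_mul, norm_zero, zero_add]
      positivity
  rw [← fderiv_eq_average hU hu hr hp, norm_mul, Real.norm_of_nonneg hc0.le, Real.norm_eq_abs,
    integral_add (hker.mul_const _) (hHr.const_mul _), integral_mul_const, integral_const_mul]
    at hbd
  have h2 : 2 / a * ∫ q : Esp d × ℝ, H (p + r • q) ≤ 2 / a * ((r ^ (d + 1))⁻¹ * a ^ 2) := by
    gcongr
  have h3 : c * |fderiv ℝ u p (tangVec d i)| ≤
      c * (a * (1 / 2 + 2 / c * (r ^ (d + 1))⁻¹)) := by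
    calc _ ≤ c * (a / 2) + 2 / a * ((r ^ (d + 1))⁻¹ * a ^ 2) := hbd.trans (by gcongr)
      _ = _ := by
        field_simp
  exact le_of_mul_le_mul_left h3 hc0

/-- Interior bound for the tangential derivatives of a harmonic function, blowing up at the
flat boundary. -/
lemma exists_interior_bound (d : ℕ) :
    ∃ K : ℝ, 1 ≤ K ∧ ∀ (u : Esp d × ℝ → ℝ) (a : ℝ), HarmonicOnH d u (upBall d 1) →
      IntegrableOn (fun p => tangGradSq d u p) (upBall d 1) → 0 < a →
      ∫ q in upBall d 1, tangGradSq d u q ≤ a ^ 2 →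
      ∀ p : Esp d × ℝ, ‖p.1‖ ≤ 41 / 64 → 0 < p.2 → p.2 ≤ 5 / 8 → ∀ i,
        |fderiv ℝ u p (tangVec d i)| ≤ K * a / p.2 ^ (d + 1) := by
  set c := ∫ q, avgKernel d q with hc
  have hc0 : 0 < c := integral_avgKernel_pos
  refine ⟨1 + 2 / c * 32 ^ (d + 1), le_add_of_nonneg_right (by positivity), ?_⟩
  intro u a hu hIb ha hle p hp1 hp2 hp3 i
  have hball : Metric.closedBall p (2 * (p.2 / 32)) ⊆ upBall d 1 := by
    intro z hz
    rw [Metric.mem_closedBall, Prod.dist_eq, max_le_iff, dist_eq_norm, Real.dist_eq,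
      abs_le] at hz
    have h1 : ‖z.1‖ ≤ ‖p.1‖ + ‖z.1 - p.1‖ := norm_le_insert' _ _
    refine ⟨?_, by linarith⟩
    have h3 : ‖z.1‖ ≤ 7 / 10 := by linarith
    have h4 : z.2 ≤ 7 / 10 := by linarith
    have h5 : 0 < z.2 := by linarith
    nlinarith [norm_nonneg z.1]
  refine (abs_fderiv_tang_le (isOpen_upBall 1) hu hIb ha hle (by positivity) hball i).trans ?_
  have hy : p.2 ^ (d + 1) ≤ 1 := pow_le_one₀ hp2.le (by linarith)
  have hy0 : 0 < p.2 ^ (d + 1) := by positivity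
  rw [le_div_iff₀ hy0, div_pow, ← hc]
  have : a * (1 / 2 + 2 / c * (p.2 ^ (d + 1) / 32 ^ (d + 1))⁻¹) * p.2 ^ (d + 1) =
      a * (p.2 ^ (d + 1) / 2 + 2 / c * 32 ^ (d + 1)) := by
    field_simp
  rw [this, mul_comm _ a]
  gcongr
  linarith

end Interior

section MaximumPrinciple

variable {d : ℕ}

lemma deriv_deriv_nonpos_of_isLocalMax {ψ : ℝ → ℝ} {x : ℝ} (h : IsLocalMax ψ x)
    (hc : ContinuousAt ψ x) : deriv (deriv ψ) x ≤ 0 := by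
  by_contra! hpos
  have hmin := isLocalMin_of_deriv_deriv_pos hpos h.deriv_eq_zero hc
  have heq : ψ =ᶠ[nhds x] fun _ => ψ x := by
    filter_upwards [h, hmin] with t h1 h2 using le_antisymm h1 h2
  have h0 : deriv (deriv ψ) x = deriv (deriv fun _ : ℝ => ψ x) x := heq.deriv.deriv_eq
  simp at h0
  exact hpos.ne' h0

lemma contDiffAt_line {f : Esp d × ℝ → ℝ} {p : Esp d × ℝ} (hf : ContDiffAt ℝ 2 f p)
    (v : Esp d × ℝ) : ContDiffAt ℝ 2 (fun t : ℝ => f (p + t • v)) 0 := by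
  have h0 : p + (0 : ℝ) • v = p := by simp
  exact ContDiffAt.comp (0 : ℝ) (h0.symm ▸ hf : ContDiffAt ℝ 2 f (p + (0 : ℝ) • v))
    (contDiffAt_const.add (contDiffAt_id.smul contDiffAt_const))

lemma lapH_sub {f g : Esp d × ℝ → ℝ} {p : Esp d × ℝ} (hf : ContDiffAt ℝ 2 f p)
    (hg : ContDiffAt ℝ 2 g p) : lapH d (fun q => f q - g q) p = lapH d f p - lapH d g p := by
  have key : ∀ v : Esp d × ℝ, deriv (deriv fun t : ℝ => f (p + t • v) - g (p + t • v)) 0 =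
      deriv (deriv fun t : ℝ => f (p + t • v)) 0 - deriv (deriv fun t : ℝ => g (p + t • v)) 0 := by
    intro v
    have := iteratedDeriv_fun_sub (n := 2) (contDiffAt_line hf v) (contDiffAt_line hg v)
    simpa only [iteratedDeriv_succ, iteratedDeriv_zero] using this
  simp only [lapH_eq_lines, key, Finset.sum_sub_distrib]
  ring

lemma lapH_nonpos_of_isLocalMax {f : Esp d × ℝ → ℝ} {p : Esp d × ℝ} (h : IsLocalMax f p)
    (hc : ContinuousAt f p) : lapH d f p ≤ 0 := by
  have key : ∀ v : Esp d × ℝ, deriv (deriv fun t : ℝ => f (p + t • v)) 0 ≤ 0 := fun v => by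
    refine deriv_deriv_nonpos_of_isLocalMax ?_ ?_
    · filter_upwards [(tendsto_add_smul p v).eventually h] with t ht
      simpa using ht
    · have h2 : Filter.Tendsto (fun t : ℝ => f (p + t • v)) (nhds 0) (nhds (f p)) :=
        hc.tendsto.comp (tendsto_add_smul p v)
      simpa [ContinuousAt] using h2
  rw [lapH_eq_lines]
  exact add_nonpos (Finset.sum_nonpos fun i _ => key _) (key _)

lemma deriv_deriv_quadratic (a b c : ℝ) :
    deriv (deriv fun t : ℝ => a + b * t + c * t ^ 2) 0 = 2 * c := by
  have h1 : (deriv fun t : ℝ => a + b * t + c * t ^ 2) = fun t => b + 2 * c * t := by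
    ext t
    have h : HasDerivAt (fun t : ℝ => a + b * t + c * t ^ 2) (b * 1 + c * (2 * t)) t := by
      have h1 := ((hasDerivAt_id t).const_mul b).const_add a
      have h2 := (hasDerivAt_pow 2 t).const_mul c
      exact (h1.add h2).congr_deriv (by simp)
    rw [h.deriv]
    ring
  rw [h1]
  simp

/-- The polynomial barrier used in the comparison argument. -/
noncomputable def barrier (d : ℕ) (x₀ : Esp d) (A σ h κ : ℝ) (q : Esp d × ℝ) : ℝ :=
  A + σ * (‖q.1 - x₀‖ ^ 2 + (d + 1) * (h ^ 2 - q.2 ^ 2)) + κ * (h - q.2)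

lemma contDiff_barrier (x₀ : Esp d) (A σ h κ : ℝ) : ContDiff ℝ 2 (barrier d x₀ A σ h κ) := by
  unfold barrier
  have h1 : ContDiff ℝ 2 fun q : Esp d × ℝ => ‖q.1 - x₀‖ ^ 2 :=
    (contDiff_fst.sub contDiff_const).norm_sq ℝ
  fun_prop

lemma lapH_barrier (x₀ : Esp d) (A σ h κ : ℝ) (q : Esp d × ℝ) :
    lapH d (barrier d x₀ A σ h κ) q = -(2 * σ) := by
  have h1 : ∀ i, (fun t : ℝ => barrier d x₀ A σ h κ (q + t • tangVec d i)) = fun t =>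
      barrier d x₀ A σ h κ q + 2 * σ * inner ℝ (q.1 - x₀) (tangVec d i).1 * t + σ * t ^ 2 := by
    intro i
    ext t
    have hn : ‖q.1 + t • (tangVec d i).1 - x₀‖ ^ 2 =
        ‖q.1 - x₀‖ ^ 2 + 2 * t * inner ℝ (q.1 - x₀) (tangVec d i).1 + t ^ 2 := by
      rw [add_sub_right_comm, norm_add_sq_real, inner_smul_right, norm_smul, mul_pow]
      simp [tangVec]
      ring
    have h2 : (tangVec d i).2 = 0 := rfl
    simp only [barrier, Prod.fst_add, Prod.smul_fst, hn, Prod.snd_add, Prod.smul_snd, h2]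
    simp
    ring
  have h2 : (fun t : ℝ => barrier d x₀ A σ h κ (q + t • vertVec d)) = fun t =>
      barrier d x₀ A σ h κ q + (-(2 * σ * (d + 1) * q.2) - κ) * t + (-(σ * (d + 1))) * t ^ 2 := by
    ext t
    simp [barrier, vertVec]
    ring
  rw [lapH_eq_lines]
  simp only [h1, h2, deriv_deriv_quadratic]
  simp
  ring

/-- Comparison with a barrier on a thin cylinder over the flat boundary. -/
lemma le_of_robin_cylinder {v : Esp d × ℝ → ℝ} {x₀ : Esp d} {r h S A g Λ : ℝ} (hr : 0 < r)
    (hh : 0 < h) (hS : 0 < S) (hg : 0 ≤ g) (hgA : g ≤ A) (hΛ : 0 ≤ Λ)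
    (hcont : ContinuousOn v {q | ‖q.1 - x₀‖ ≤ r ∧ 0 ≤ q.2 ∧ q.2 ≤ h})
    (hharm : ∀ q : Esp d × ℝ, ‖q.1 - x₀‖ < r → 0 < q.2 → q.2 < h →
      ContDiffAt ℝ 2 v q ∧ lapH d v q = 0)
    (hvS : ∀ q : Esp d × ℝ, ‖q.1 - x₀‖ ≤ r → 0 ≤ q.2 → q.2 ≤ h → v q ≤ S)
    (htop : ∀ x : Esp d, ‖x - x₀‖ ≤ r → v (x, h) ≤ A)
    (hbot : ∀ x : Esp d, ‖x - x₀‖ < r → g < v (x, 0) →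
      ∃ D, NormalDeriv d v x D ∧ -(Λ * (v (x, 0) + g)) ≤ D)
    {y : ℝ} (hy0 : 0 ≤ y) (hyh : y ≤ h) :
    v (x₀, y) ≤ A + S * (d + 1) * (h / r) ^ 2 + (Λ * (S + g) + S) * h := by
  set Q : Set (Esp d × ℝ) := {q | ‖q.1 - x₀‖ ≤ r ∧ 0 ≤ q.2 ∧ q.2 ≤ h} with hQ
  set κ : ℝ := Λ * (S + g) + S with hκ
  have hκ0 : 0 < κ := by positivity
  set σ : ℝ := S / r ^ 2 with hσ
  have hσ0 : 0 < σ := by positivity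
  set B := barrier d x₀ A σ h κ with hB
  have hQc : IsCompact Q := by
    have : Q = Metric.closedBall x₀ r ×ˢ Icc 0 h := by
      ext q
      simp [hQ, dist_eq_norm]
    rw [this]
    exact (isCompact_closedBall x₀ r).prod isCompact_Icc
  have hBc : Continuous B := (contDiff_barrier x₀ A σ h κ).continuous
  obtain ⟨q, hqQ, hqmax⟩ := hQc.exists_isMaxOn
    ⟨(x₀, 0), by simp [hQ, hr.le, hh.le]⟩ (hcont.sub hBc.continuousOn)
  have hmax : ∀ z ∈ Q, v z - B z ≤ v q - B q := fun z hz => hqmax hz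
  have hBA : ∀ z ∈ Q, A ≤ B z := by
    intro z hz
    have h1 : z.2 ^ 2 ≤ h ^ 2 := pow_le_pow_left₀ hz.2.1 hz.2.2 2
    have h2 : 0 ≤ σ * (‖z.1 - x₀‖ ^ 2 + (d + 1) * (h ^ 2 - z.2 ^ 2)) :=
      mul_nonneg hσ0.le (add_nonneg (sq_nonneg _) (mul_nonneg (by positivity) (by linarith)))
    have h3 : 0 ≤ κ * (h - z.2) := mul_nonneg hκ0.le (by linarith [hz.2.2])
    simp only [hB, barrier]
    linarith
  have hq0 : v q - B q ≤ 0 := by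
    by_contra! hpos
    obtain ⟨hq1, hq2, hq3⟩ := hqQ
    have hAB := hBA q ⟨hq1, hq2, hq3⟩
    rcases hq3.eq_or_lt with htop' | hlt
    · have := htop q.1 hq1
      rw [← htop'] at this
      simp only [Prod.mk.eta] at this
      linarith
    rcases hq1.eq_or_lt with hside | hin
    · have h1 : q.2 ^ 2 ≤ h ^ 2 := pow_le_pow_left₀ hq2 hq3 2
      have h2 : 0 ≤ σ * ((d + 1) * (h ^ 2 - q.2 ^ 2)) :=
        mul_nonneg hσ0.le (mul_nonneg (by positivity) (by linarith))
      have h3 : 0 ≤ κ * (h - q.2) := mul_nonneg hκ0.le (by linarith)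
      have h4 : σ * r ^ 2 = S := by rw [hσ]; field_simp
      have h5 := hvS q hq1 hq2 hq3
      have h6 : B q = A + σ * r ^ 2 + σ * ((d + 1) * (h ^ 2 - q.2 ^ 2)) + κ * (h - q.2) := by
        simp only [hB, barrier, hside]
        ring
      linarith
    rcases hq2.eq_or_lt with hbot' | hin2
    · have hqx : q = (q.1, 0) := Prod.ext rfl hbot'.symm
      set x := q.1
      rw [hqx] at hmax hpos hAB
      obtain ⟨D, hD, hDle⟩ := hbot x hin (by linarith)
      have hle : D ≤ -κ := by
        refine le_of_tendsto hD ?_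
        filter_upwards [Ioo_mem_nhdsGT hh] with t ht
        have h1 := hmax (x, t) ⟨hq1, ht.1.le, ht.2.le⟩
        rw [div_le_iff₀ ht.1]
        have h2 : B (x, t) - B (x, 0) = -(σ * (d + 1) * t ^ 2) - κ * t := by
          simp only [hB, barrier]
          ring
        have h3 : 0 ≤ σ * (d + 1) * t ^ 2 := by positivity
        linarith
      have h5 := hvS (x, 0) hq1 le_rfl hh.le
      have h6 : Λ * (v (x, 0) + g) ≤ Λ * (S + g) := by gcongr
      linarith
    · obtain ⟨hC, hl⟩ := hharm q hin hin2 hlt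
      have hBd := (contDiff_barrier x₀ A σ h κ).contDiffAt (x := q)
      have hloc : IsLocalMax (fun z => v z - B z) q := by
        have hopen : IsOpen {z : Esp d × ℝ | ‖z.1 - x₀‖ < r ∧ 0 < z.2 ∧ z.2 < h} := by
          refine IsOpen.and (isOpen_lt (by fun_prop) (by fun_prop)) (IsOpen.and ?_ ?_)
          · exact isOpen_lt (by fun_prop) (by fun_prop)
          · exact isOpen_lt (by fun_prop) (by fun_prop)
        filter_upwards [hopen.mem_nhds ⟨hin, hin2, hlt⟩] with z hz
        exact hmax z ⟨hz.1.le, hz.2.1.le, hz.2.2.le⟩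
      have h1 := lapH_nonpos_of_isLocalMax hloc (hC.sub hBd).continuousAt
      rw [lapH_sub hC hBd, hl, lapH_barrier] at h1
      linarith
  have hfin := hmax (x₀, y) ⟨by simpa using hr.le, hy0, hyh⟩
  have hBy : B (x₀, y) ≤ A + S * (d + 1) * (h / r) ^ 2 + κ * h := by
    have h1 : B (x₀, y) = A + S * (d + 1) * (h / r) ^ 2 + κ * h
        - (σ * (d + 1) * y ^ 2 + κ * y) := by
      simp only [hB, barrier, hσ, sub_self, norm_zero]
      field_simp
      ring
    have h2 : 0 ≤ σ * (d + 1) * y ^ 2 + κ * y := by positivity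
    linarith
  linarith

set_option maxHeartbeats 800000 in
/-- A harmonic function on a half ball with a one-sided Robin condition, whose growth at the flat
boundary is at most polynomial, is bounded. -/
lemma exists_robin_bound (d : ℕ) {K Λ : ℝ} (hK : 1 ≤ K) (hΛ : 0 ≤ Λ) :
    ∃ C : ℝ, 0 < C ∧ ∀ (v : Esp d × ℝ → ℝ) (A : ℝ), 0 < A →
      ContinuousOn v {q | ‖q‖ ≤ 5 / 8 ∧ 0 ≤ q.2} →
      (∀ q : Esp d × ℝ, ‖q‖ < 5 / 8 → 0 < q.2 → ContDiffAt ℝ 2 v q ∧ lapH d v q = 0) →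
      (∀ q : Esp d × ℝ, ‖q‖ ≤ 5 / 8 → 0 < q.2 → v q ≤ K * A / q.2 ^ (d + 1)) →
      (∀ x : Esp d, ‖x‖ < 5 / 8 → A < v (x, 0) →
        ∃ D, NormalDeriv d v x D ∧ -(Λ * (v (x, 0) + A)) ≤ D) →
      ∀ q : Esp d × ℝ, ‖q‖ ≤ 1 / 2 → 0 ≤ q.2 → v q ≤ C * A := by
  set T : ℝ := 2 * 2 ^ (d + 1) * (d + 2 + Λ) with hT
  have h2d : (1 : ℝ) ≤ 2 ^ (d + 1) := one_le_pow₀ (by norm_num)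
  have hd2 : (1 : ℝ) ≤ d + 2 + Λ := by
    have : (0 : ℝ) ≤ d := Nat.cast_nonneg d
    linarith
  have hT1 : 1 ≤ T := by rw [hT]; nlinarith
  have hT0 : 0 < T := by linarith
  set η : ℝ := T⁻¹ with hη
  have hη0 : 0 < η := by positivity
  have hη1 : η ≤ 1 := inv_le_one_of_one_le₀ hT1
  set C₁ : ℝ := 2 * K * (2 / η) ^ (d + 1) + 2 * Λ with hC₁
  have hC₁0 : 0 < C₁ := by positivity
  refine ⟨8 ^ (d + 1) * C₁, by positivity, ?_⟩
  intro v A hA hcont hharm hgrow hbot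
  set K₀ : Set (Esp d × ℝ) := {q | ‖q‖ ≤ 5 / 8 ∧ 0 ≤ q.2} with hK₀
  have hK₀c : IsCompact K₀ := by
    have : K₀ = Metric.closedBall 0 (5 / 8) ∩ {q | 0 ≤ q.2} := by
      ext q
      simp [hK₀]
    rw [this]
    exact (isCompact_closedBall _ _).inter_right (isClosed_le (by fun_prop) (by fun_prop))
  have hwc : Continuous fun q : Esp d × ℝ => (5 / 8 - ‖q‖) ^ (d + 1) := by fun_prop
  obtain ⟨p, hp, hpmax⟩ := hK₀c.exists_isMaxOn ⟨0, by norm_num [hK₀]⟩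
    (hcont.mul hwc.continuousOn)
  have hmax : ∀ q ∈ K₀, v q * (5 / 8 - ‖q‖) ^ (d + 1) ≤ v p * (5 / 8 - ‖p‖) ^ (d + 1) :=
    fun q hq => hpmax hq
  have hM : v p * (5 / 8 - ‖p‖) ^ (d + 1) ≤ C₁ * A := by
    by_contra! hlt
    set δ : ℝ := 5 / 8 - ‖p‖ with hδ
    have hδ0 : 0 ≤ δ := by linarith [hp.1]
    have hMpos : 0 < v p * δ ^ (d + 1) := lt_trans (by positivity) hlt
    have hδpos : 0 < δ := by
      rcases hδ0.eq_or_lt with h | h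
      · rw [← h, zero_pow (by simp), mul_zero] at hMpos
        exact absurd hMpos (lt_irrefl _)
      · exact h
    have hvp : 0 < v p := pos_of_mul_pos_left hMpos (by positivity)
    have hδ1 : δ ≤ 1 := by linarith [norm_nonneg p]
    have hδN : δ ^ (d + 1) ≤ 1 := pow_le_one₀ hδ0 hδ1
    set h : ℝ := η * (δ / 2) with hh
    have hh0 : 0 < h := by positivity
    have hhδ : h ≤ δ / 2 := by rw [hh]; nlinarith
    have hhη : h ≤ η := by rw [hh]; nlinarith
    have hscale : K * A / h ^ (d + 1) * δ ^ (d + 1) = K * (2 / η) ^ (d + 1) * A := by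
      rw [hh, mul_pow, div_pow, div_pow]
      field_simp
    have hscale0 : 0 ≤ K * (2 / η) ^ (d + 1) * A := by positivity
    rcases le_or_gt h p.2 with hcase | hcase
    · have h1 : v p ≤ K * A / h ^ (d + 1) :=
        (hgrow p hp.1 (hh0.trans_le hcase)).trans (by gcongr)
      have h2 : v p * δ ^ (d + 1) ≤ K * A / h ^ (d + 1) * δ ^ (d + 1) := by gcongr
      have h3 : 0 ≤ Λ * A := by positivity
      rw [hC₁] at hlt
      nlinarith
    · have hsub : ∀ q : Esp d × ℝ, ‖q.1 - p.1‖ ≤ δ / 2 → 0 ≤ q.2 → q.2 ≤ h →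
          ‖q‖ ≤ 5 / 8 - δ / 2 := by
        intro q h1 h2 h3
        have h4 : ‖q - p‖ ≤ δ / 2 := by
          rw [Prod.norm_def]
          refine max_le h1 ?_
          rw [Real.norm_eq_abs, abs_le]
          constructor
          · simp only [Prod.snd_sub]; linarith
          · simp only [Prod.snd_sub]; linarith [hp.2]
        have := norm_le_insert' q p
        linarith
      have hcyl := le_of_robin_cylinder (v := v) (x₀ := p.1) (r := δ / 2) (h := h)
        (S := 2 ^ (d + 1) * v p) (A := K * A / h ^ (d + 1)) (g := A) (Λ := Λ)
        (by positivity) hh0 (by positivity) hA.le ?_ hΛ ?_ ?_ ?_ ?_ ?_ hp.2 hcase.le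
      · have hratio : h / (δ / 2) = η := by
          rw [hh]
          field_simp
        rw [hratio, Prod.mk.eta] at hcyl
        have h1 : η ^ 2 ≤ η := by nlinarith
        have hSη : 2 ^ (d + 1) * v p * (d + 1) * η ^ 2 +
            (Λ * (2 ^ (d + 1) * v p + A) + 2 ^ (d + 1) * v p) * h ≤ v p / 2 + Λ * A := by
          calc _ ≤ 2 ^ (d + 1) * v p * (d + 1) * η +
            (Λ * (2 ^ (d + 1) * v p + A) + 2 ^ (d + 1) * v p) * η := by gcongr
            _ = T * η * v p / 2 + Λ * A * η := by rw [hT]; ring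
            _ ≤ v p / 2 + Λ * A := by
              rw [hη, mul_inv_cancel₀ hT0.ne', one_mul, ← hη]
              have : Λ * A * η ≤ Λ * A * 1 := by gcongr
              linarith
        have h2 : v p ≤ 2 * (K * A / h ^ (d + 1)) + 2 * (Λ * A) := by linarith
        have h3 : v p * δ ^ (d + 1) ≤
            (2 * (K * A / h ^ (d + 1)) + 2 * (Λ * A)) * δ ^ (d + 1) := by gcongr
        have h4 : 2 * (Λ * A) * δ ^ (d + 1) ≤ 2 * (Λ * A) * 1 := by gcongr
        rw [hC₁] at hlt
        nlinarith
      · rw [le_div_iff₀ (by positivity)]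
        have : h ^ (d + 1) ≤ 1 := pow_le_one₀ hh0.le (hhη.trans hη1)
        nlinarith
      · refine hcont.mono fun q hq => ⟨?_, hq.2.1⟩
        linarith [hsub q hq.1 hq.2.1 hq.2.2]
      · intro q h1 h2 h3
        exact hharm q (by linarith [hsub q h1.le h2.le h3.le]) h2
      · intro q h1 h2 h3
        have h4 := hsub q h1 h2 h3
        rcases le_or_gt (v q) 0 with h5 | h5
        · exact h5.trans (by positivity)
        · have h6 := hmax q ⟨by linarith, h2⟩
          have h7 : v q * (δ / 2) ^ (d + 1) ≤ v q * (5 / 8 - ‖q‖) ^ (d + 1) := by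
            gcongr
            linarith
          have h8 : v q * (δ / 2) ^ (d + 1) ≤ 2 ^ (d + 1) * v p * (δ / 2) ^ (d + 1) := by
            refine (h7.trans h6).trans_eq ?_
            rw [div_pow]
            field_simp
          exact le_of_mul_le_mul_right h8 (by positivity)
      · intro x hx
        exact hgrow (x, h) (by linarith [hsub (x, h) hx hh0.le le_rfl]) hh0
      · intro x hx hx2
        refine hbot x ?_ hx2
        have := hsub (x, 0) hx.le le_rfl hh0.le
        rw [Prod.norm_def] at this
        linarith [le_max_left ‖x‖ ‖(0 : ℝ)‖]
  intro q hq hq2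
  rcases le_or_gt (v q) 0 with h5 | h5
  · exact h5.trans (by positivity)
  · have h6 := (hmax q ⟨by linarith, hq2⟩).trans hM
    have h7 : v q * (1 / 8) ^ (d + 1) ≤ v q * (5 / 8 - ‖q‖) ^ (d + 1) := by
      gcongr
      linarith
    have h8 := h7.trans h6
    rw [div_pow, one_pow, mul_one_div, div_le_iff₀ (by positivity)] at h8
    linarith

end MaximumPrinciple

section TwoPhase

variable {d : ℕ}

/-- One-sided Lipschitz property of the boundary condition of the two-phase problem. -/
lemma GoodF.neg_mul_sub_le {θ L : ℝ} {f : ℝ → ℝ} (hf : GoodF θ L f) {s₁ s₂ L₁ L₂ : ℝ}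
    (h₁ : |L₁| ≤ θ) (h₂ : |L₂| ≤ θ) (hs₁ : s₁ ≠ 0 → L₁ = f |s₁| * Real.sign s₁)
    (hs₂ : s₂ ≠ 0 → L₂ = f |s₂| * Real.sign s₂) (hlt : s₂ < s₁) :
    -(|L| * (s₁ - s₂)) ≤ L₁ - L₂ := by
  obtain ⟨h0, hpos, hlip⟩ := hf
  have hlip' : ∀ s t : ℝ, 0 ≤ s → 0 ≤ t → -(|L| * |s - t|) ≤ f s - f t := fun s t hs ht => by
    have h3 := neg_le_of_abs_le (hlip s t hs ht)
    have h4 : L * |s - t| ≤ |L| * |s - t| := by gcongr; exact le_abs_self L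
    linarith
  rw [abs_le] at h₁ h₂
  rcases lt_trichotomy s₂ 0 with h | h | h
  · have e₂ := hs₂ h.ne
    rw [abs_of_neg h, Real.sign_of_neg h] at e₂
    rcases lt_trichotomy s₁ 0 with h' | h' | h'
    · have e₁ := hs₁ h'.ne
      rw [abs_of_neg h', Real.sign_of_neg h'] at e₁
      have := hlip' (-s₂) (-s₁) (by linarith) (by linarith)
      rw [abs_of_pos (by linarith : 0 < -s₂ - -s₁)] at this
      linarith
    · have := hlip' (-s₂) 0 (by linarith) le_rfl
      rw [abs_of_pos (by linarith : 0 < -s₂ - 0)] at this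
      rw [h']
      linarith
    · have e₁ := hs₁ h'.ne'
      rw [abs_of_pos h', Real.sign_of_pos h'] at e₁
      have p₁ := (hpos s₁ h'.le).1
      have p₂ := (hpos (-s₂) (by linarith)).1
      have : 0 ≤ |L| * (s₁ - s₂) := mul_nonneg (abs_nonneg _) (by linarith)
      linarith
  · have h' : 0 < s₁ := h ▸ hlt
    have e₁ := hs₁ h'.ne'
    rw [abs_of_pos h', Real.sign_of_pos h'] at e₁
    have := hlip' s₁ 0 h'.le le_rfl
    rw [sub_zero, abs_of_pos h'] at this
    rw [h, sub_zero]
    linarith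
  · have h' : 0 < s₁ := h.trans hlt
    have e₁ := hs₁ h'.ne'
    have e₂ := hs₂ h.ne'
    rw [abs_of_pos h', Real.sign_of_pos h'] at e₁
    rw [abs_of_pos h, Real.sign_of_pos h] at e₂
    have := hlip' s₁ s₂ h'.le h.le
    rw [abs_of_pos (by linarith : 0 < s₁ - s₂)] at this
    linarith

lemma lapH_comp_add_right (u : Esp d × ℝ → ℝ) (w p : Esp d × ℝ) :
    lapH d (fun q => u (q + w)) p = lapH d u (p + w) := by
  simp only [lapH_eq_lines, add_right_comm]

lemma NormalDeriv.translate_sub {u : Esp d × ℝ → ℝ} {x e : Esp d} {L₁ L₂ : ℝ}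
    (h₁ : NormalDeriv d u (x + e) L₁) (h₂ : NormalDeriv d u x L₂) :
    NormalDeriv d (fun q => u (q + (e, 0)) - u q) x (L₁ - L₂) := by
  refine (Filter.Tendsto.sub h₁ h₂).congr fun t => ?_
  simp only [Prod.mk_add_mk, add_zero]
  ring

lemma mem_upBall_union_flatBall {q : Esp d × ℝ} (h1 : ‖q.1‖ ≤ 41 / 64) (h2 : 0 ≤ q.2)
    (h3 : q.2 ≤ 5 / 8) : q ∈ upBall d 1 ∪ flatBall d 1 := by
  have h : ‖q.1‖ ^ 2 + q.2 ^ 2 < 1 ^ 2 := by nlinarith [norm_nonneg q.1]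
  rcases h2.eq_or_lt with h0 | h0
  · exact Or.inr ⟨h, h0.symm⟩
  · exact Or.inl ⟨h, h0⟩

lemma mem_upBall_one {q : Esp d × ℝ} (h1 : ‖q.1‖ ≤ 41 / 64) (h2 : 0 < q.2)
    (h3 : q.2 ≤ 5 / 8) : q ∈ upBall d 1 :=
  ⟨by nlinarith [norm_nonneg q.1], h2⟩

/-- Bound for the tangential difference quotients of a solution, given an interior bound for its
tangential derivative. -/
lemma sub_le_of_twoPhaseSol {θ L G a K C h : ℝ} {f : ℝ → ℝ} {φ : Esp d → ℝ}
    {u : Esp d × ℝ → ℝ} {e : Esp d} (hf : GoodF θ L f)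
    (hφ : ∀ x : Esp d, ‖x‖ < 1 → DifferentiableAt ℝ φ x)
    (hu : TwoPhaseSolH d θ f φ u) (hG : ∀ x : Esp d, ‖x‖ < 1 → ‖fderiv ℝ φ x‖ ≤ G)
    (ha : 0 < a) (hGa : G ≤ a) (he : ‖e‖ = 1) (hh : 0 < h) (hh' : h ≤ 1 / 64)
    (hIb : ∀ q : Esp d × ℝ, ‖q.1‖ ≤ 41 / 64 → 0 < q.2 → q.2 ≤ 5 / 8 →
      |fderiv ℝ u q (e, 0)| ≤ K * a / q.2 ^ (d + 1))
    (hC : ∀ (v : Esp d × ℝ → ℝ) (A : ℝ), 0 < A →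
      ContinuousOn v {q | ‖q‖ ≤ 5 / 8 ∧ 0 ≤ q.2} →
      (∀ q : Esp d × ℝ, ‖q‖ < 5 / 8 → 0 < q.2 → ContDiffAt ℝ 2 v q ∧ lapH d v q = 0) →
      (∀ q : Esp d × ℝ, ‖q‖ ≤ 5 / 8 → 0 < q.2 → v q ≤ K * A / q.2 ^ (d + 1)) →
      (∀ x : Esp d, ‖x‖ < 5 / 8 → A < v (x, 0) →
        ∃ D, NormalDeriv d v x D ∧ -(|L| * (v (x, 0) + A)) ≤ D) →
      ∀ q : Esp d × ℝ, ‖q‖ ≤ 1 / 2 → 0 ≤ q.2 → v q ≤ C * A)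
    {p : Esp d × ℝ} (hp : ‖p‖ ≤ 1 / 2) (hp2 : 0 ≤ p.2) :
    u (p + (h • e, 0)) - u p ≤ C * (h * a) := by
  obtain ⟨hcont, hharm, hbdry⟩ := hu
  have hshift : ∀ (x : Esp d) (t : ℝ), 0 ≤ t → t ≤ h → ‖x‖ ≤ 5 / 8 → ‖x + t • e‖ ≤ 41 / 64 := by
    intro x t ht0 ht hx
    have := norm_add_le x (t • e)
    rw [norm_smul, he, Real.norm_of_nonneg ht0] at this
    linarith
  have hfst : ∀ q : Esp d × ℝ, ‖q.1‖ ≤ ‖q‖ := fun q => norm_fst_le q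
  have hsnd : ∀ q : Esp d × ℝ, q.2 ≤ ‖q‖ := fun q => (le_abs_self _).trans (norm_snd_le q)
  have hcd : ∀ q : Esp d × ℝ, ‖q.1‖ ≤ 41 / 64 → 0 < q.2 → q.2 ≤ 5 / 8 →
      ContDiffAt ℝ 2 u q := fun q h1 h2 h3 =>
    hharm.1.contDiffAt ((isOpen_upBall 1).mem_nhds (mem_upBall_one h1 h2 h3))
  refine hC (fun q => u (q + (h • e, 0)) - u q) (h * a) (by positivity) ?_ ?_ ?_ ?_ p hp hp2
  · refine ContinuousOn.sub (hcont.comp (by fun_prop) fun q hq => ?_) (hcont.mono fun q hq => ?_)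
    · refine mem_upBall_union_flatBall ?_ ?_ ?_
      · exact hshift q.1 h hh.le le_rfl ((hfst q).trans hq.1)
      · simpa using hq.2
      · simpa using (hsnd q).trans hq.1
    · exact mem_upBall_union_flatBall (by linarith [hfst q, hq.1]) hq.2 ((hsnd q).trans hq.1)
  · intro q hq hq2
    have m0 : ‖q.1‖ ≤ 41 / 64 := by linarith [hfst q]
    have m1 : ‖(q + (h • e, 0)).1‖ ≤ 41 / 64 :=
      hshift q.1 h hh.le le_rfl ((hfst q).trans hq.le)
    have m2 : 0 < (q + ((h • e, 0) : Esp d × ℝ)).2 := by simpa using hq2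
    have m3 : (q + ((h • e, 0) : Esp d × ℝ)).2 ≤ 5 / 8 := by simpa using (hsnd q).trans hq.le
    have m4 : q.2 ≤ 5 / 8 := (hsnd q).trans hq.le
    have c1 : ContDiffAt ℝ 2 (fun q => u (q + (h • e, 0))) q :=
      (hcd _ m1 m2 m3).comp q (contDiffAt_id.add contDiffAt_const)
    have c2 := hcd q m0 hq2 m4
    refine ⟨c1.sub c2, ?_⟩
    rw [lapH_sub c1 c2, lapH_comp_add_right, hharm.2 _ (mem_upBall_one m1 m2 m3),
      hharm.2 _ (mem_upBall_one m0 hq2 m4), sub_zero]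
  · intro q hq hq2
    have m4 : q.2 ≤ 5 / 8 := (hsnd q).trans hq
    have hb : ∀ t ∈ Icc 0 h, HasDerivWithinAt (fun t : ℝ => u (q + t • ((e, 0) : Esp d × ℝ)))
        (fderiv ℝ u (q + t • ((e, 0) : Esp d × ℝ)) (e, 0)) (Icc 0 h) t ∧
        ‖fderiv ℝ u (q + t • ((e, 0) : Esp d × ℝ)) (e, 0)‖ ≤ K * a / q.2 ^ (d + 1) := by
      intro t ht
      have m1 : ‖(q + t • ((e, 0) : Esp d × ℝ)).1‖ ≤ 41 / 64 :=
        hshift q.1 t ht.1 ht.2 ((hfst q).trans hq)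
      have m2 : (q + t • ((e, 0) : Esp d × ℝ)).2 = q.2 := by simp
      have hd := (hcd _ m1 (m2 ▸ hq2) (m2 ▸ m4)).differentiableAt (by norm_num)
      refine ⟨(hd.hasFDerivAt.comp_hasDerivAt t
        (hasDerivAt_add_smul q (e, 0) t)).hasDerivWithinAt, ?_⟩
      have := hIb _ m1 (m2 ▸ hq2) (m2 ▸ m4)
      rwa [m2] at this
    have hmv := (convex_Icc 0 h).norm_image_sub_le_of_norm_hasDerivWithin_le
      (fun t ht => (hb t ht).1) (fun t ht => (hb t ht).2) (left_mem_Icc.2 hh.le)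
      (right_mem_Icc.2 hh.le)
    rw [sub_zero, Real.norm_of_nonneg hh.le, Real.norm_eq_abs] at hmv
    have h1 := (le_abs_self _).trans hmv
    simp only [Prod.smul_mk, smul_zero, zero_smul] at h1
    rw [add_zero] at h1
    refine h1.trans_eq ?_
    ring
  · intro x hx hgt
    have hx1 : ‖x‖ < 1 := by linarith
    have hxe : ‖x + h • e‖ < 1 := by linarith [hshift x h hh.le le_rfl hx.le]
    obtain ⟨L₁, hL₁, hθ₁, hs₁⟩ := hbdry (x + h • e) hxe
    obtain ⟨L₂, hL₂, hθ₂, hs₂⟩ := hbdry x hx1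
    refine ⟨L₁ - L₂, hL₁.translate_sub hL₂, ?_⟩
    simp only [Prod.mk_add_mk, add_zero] at hgt ⊢
    have hφd : |φ (x + h • e) - φ x| ≤ h * a := by
      have := (convex_ball (0 : Esp d) 1).norm_image_sub_le_of_norm_fderiv_le (𝕜 := ℝ)
        (fun z hz => hφ z (by simpa using hz)) (fun z hz => hG z (by simpa using hz))
        (x := x) (y := x + h • e) (by simpa using hx1) (by simpa using hxe)
      rw [add_sub_cancel_left, norm_smul, he, Real.norm_of_nonneg hh.le, mul_one,
        Real.norm_eq_abs] at this
      nlinarith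
    rw [abs_le] at hφd
    have hkey := hf.neg_mul_sub_le (s₁ := u (x + h • e, 0) - φ (x + h • e))
      (s₂ := u (x, 0) - φ x) hθ₁ hθ₂ (fun hne => hs₁ (sub_ne_zero.1 hne))
      (fun hne => hs₂ (sub_ne_zero.1 hne)) (by linarith)
    have : |L| * (u (x + h • e, 0) - φ (x + h • e) - (u (x, 0) - φ x)) ≤
        |L| * (u (x + h • e, 0) - u (x, 0) + h * a) := by
      gcongr
      linarith
    linarith

lemma norm_le_of_mem_upBall {r : ℝ} (hr : 0 ≤ r) {p : Esp d × ℝ} (hp : p ∈ upBall d r) :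
    ‖p‖ ≤ r := by
  have h := hp.1
  rw [Prod.norm_def]
  refine max_le ?_ ?_
  · exact abs_le_of_sq_le_sq' (by nlinarith [sq_nonneg p.2]) hr |>.2
  · rw [Real.norm_eq_abs]
    exact abs_le_of_sq_le_sq (by nlinarith [sq_nonneg ‖p.1‖]) hr

end TwoPhase

/-- **tangential Lipschitz bound.** There is `C > 0`, depending only on `d`
and the Lipschitz constant `L` of `f`, such that every solution `u` of the two-phase thin
obstacle problem with `∇_x u ∈ L²(B₁⁺)` and `C^{1,1}` obstacle `φ` satisfies
`|∇_x u| ≤ C(‖∇_x u‖_{L²(B₁⁺)} + ‖∇φ‖_{L^∞(B₁')})` in `B_{1/2}⁺`. -/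
theorem statement12
    (d : ℕ) (hd : 1 ≤ d) (L : ℝ) :
    ∃ C > 0, ∀ (θ : ℝ) (f : ℝ → ℝ) (φ : Esp d → ℝ) (u : Esp d × ℝ → ℝ) (G : ℝ),
      0 < θ → GoodF θ L f →
      (∀ x : Esp d, ‖x‖ < 1 → DifferentiableAt ℝ φ x) →
      (∃ M : ℝ, ∀ x y : Esp d, ‖x‖ < 1 → ‖y‖ < 1 →
        ‖fderiv ℝ φ x - fderiv ℝ φ y‖ ≤ M * ‖x - y‖) →
      TwoPhaseSolH d θ f φ u →
      IntegrableOn (fun p => tangGradSq d u p) (upBall d 1) volume →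
      (∀ x : Esp d, ‖x‖ < 1 → ‖fderiv ℝ φ x‖ ≤ G) →
      ∀ p ∈ upBall d (1/2),
        Real.sqrt (tangGradSq d u p)
          ≤ C * (Real.sqrt (∫ q in upBall d 1, tangGradSq d u q) + G) := by
  obtain ⟨K, hK, hKint⟩ := exists_interior_bound d
  obtain ⟨C, hC, hCrob⟩ := exists_robin_bound d hK (abs_nonneg L)
  have hd0 : (0 : ℝ) < d := by exact_mod_cast hd
  refine ⟨Real.sqrt d * C, by positivity, ?_⟩
  intro θ f φ u G _ hf hφ _ hu hI hG p hp
  set I := ∫ q in upBall d 1, tangGradSq d u q with hIdef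
  have hI0 : 0 ≤ I := integral_nonneg fun _ => tangGradSq_nonneg _ _
  have hpn : ‖p‖ ≤ 1 / 2 := norm_le_of_mem_upBall (by norm_num) hp
  have hpU : p ∈ upBall d 1 := ⟨by have := hp.1; norm_num at this ⊢; linarith, hp.2⟩
  have hdiff : DifferentiableAt ℝ u p :=
    (hu.2.1.1.contDiffAt ((isOpen_upBall 1).mem_nhds hpU)).differentiableAt (by norm_num)
  have hG0 : 0 ≤ G := (norm_nonneg _).trans (hG 0 (by simp))
  have hbound : ∀ a, Real.sqrt I + G < a → Real.sqrt (tangGradSq d u p) ≤ Real.sqrt d * C * a := by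
    intro a ha
    have hs := Real.sqrt_nonneg I
    have ha0 : 0 < a := by linarith
    have hIa : I ≤ a ^ 2 := (Real.sqrt_le_left ha0.le).1 (by linarith)
    have hdir : ∀ (i : Fin d) (σ : ℝ), |σ| = 1 → σ * fderiv ℝ u p (tangVec d i) ≤ C * a := by
      intro i σ hσ
      set e : Esp d := σ • EuclideanSpace.single i 1 with he
      have hev : ((e, 0) : Esp d × ℝ) = σ • tangVec d i := by simp [he, tangVec]
      have hfd : ∀ q, fderiv ℝ u q (e, 0) = σ * fderiv ℝ u q (tangVec d i) := fun q => by
        rw [hev, map_smul, smul_eq_mul]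
      have hder := (hdiff.hasFDerivAt.comp_hasDerivAt_of_eq 0 (hasDerivAt_add_smul p (e, 0) 0)
        (by simp)).tendsto_slope_zero_right
      rw [← hfd]
      refine le_of_tendsto hder ?_
      filter_upwards [Ioo_mem_nhdsGT (show (0 : ℝ) < 1 / 64 by norm_num)] with t ht
      have := sub_le_of_twoPhaseSol hf hφ hu hG ha0 (by linarith) (e := e)
        (by simp [he, norm_smul, hσ]) ht.1 ht.2.le
        (fun q h1 h2 h3 => by
          rw [hfd, abs_mul, hσ, one_mul]
          exact hKint u a hu.2.1 hI ha0 hIa q h1 h2 h3 i) hCrob hpn hp.2.le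
      simp only [Function.comp_apply, zero_add, smul_eq_mul, Prod.smul_mk, mul_zero, zero_smul,
        Prod.mk_zero_zero, add_zero]
      rw [inv_mul_le_iff₀ ht.1]
      linarith
    have habs : ∀ i, (fderiv ℝ u p (tangVec d i)) ^ 2 ≤ (C * a) ^ 2 := fun i =>
      sq_le_sq' (by linarith [hdir i (-1) (by simp)]) (by linarith [hdir i 1 (by simp)])
    rw [tangGradSq_eq hdiff]
    refine Real.sqrt_le_iff.2 ⟨by positivity, ?_⟩
    calc ∑ i, (fderiv ℝ u p (tangVec d i)) ^ 2 ≤ ∑ _i : Fin d, (C * a) ^ 2 :=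
        Finset.sum_le_sum fun i _ => habs i
      _ = (Real.sqrt d * C * a) ^ 2 := by
        rw [mul_assoc, mul_pow (Real.sqrt d), Real.sq_sqrt hd0.le]
        simp
  have hc0 : 0 < Real.sqrt d * C := by positivity
  have := le_of_forall_gt_imp_ge_of_dense (a₂ := Real.sqrt I + G)
    (a₁ := Real.sqrt (tangGradSq d u p) / (Real.sqrt d * C))
    fun a ha => (div_le_iff₀' hc0).2 (hbound a ha)
  exact (div_le_iff₀' hc0).1 this
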